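/- Let f : ℝ^n → ℝ be differentiable with κ-Lipschitz gradient on the relevant segment, let Ω be closed convex, x ∈ Ω, g = ∇f(x), β > 0, d = P_Ω(x - β • g) - x with d ≠ 0, and δ ∈ (0,1). If the Armijo condition fails at step β, i.e., f(x + d) - f(x) > δ·⟨g, d⟩, then β > 2(1 - δ)/κ. -/

import Mathlib

open RealInnerProductSpace

theorem armijo_failure_stepsize_bound {n : ℕ}
    (Ω : Set (EuclideanSpace ℝ (Fin n)))
    (hΩne : Ω.Nonempty) (hΩcl : IsClosed Ω) (hΩconv : Convex ℝ Ω)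
    (P : EuclideanSpace ℝ (Fin n) → EuclideanSpace ℝ (Fin n))
    (hP : ∀ z, P z ∈ Ω ∧ ∀ y ∈ Ω, ‖z - P z‖ ≤ ‖z - y‖)
    (f : EuclideanSpace ℝ (Fin n) → ℝ)
    (G : EuclideanSpace ℝ (Fin n) → EuclideanSpace ℝ (Fin n))
    (x d : EuclideanSpace ℝ (Fin n)) (hx : x ∈ Ω)
    (κ β δ : ℝ) (hκ : 0 < κ) (hβ : 0 < β) (hδ : δ ∈ Set.Ioo (0 : ℝ) 1)
    (hd : d = P (x - β • G x) - x) (hdne : d ≠ 0)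
    (hdiff : ∀ t ∈ Set.Icc (0 : ℝ) 1, HasGradientAt f (G (x + t • d)) (x + t • d))
    (hlip : ∀ s ∈ Set.Icc (0 : ℝ) 1, ∀ t ∈ Set.Icc (0 : ℝ) 1,
      ‖G (x + s • d) - G (x + t • d)‖ ≤ κ * (|s - t| * ‖d‖))
    (harmijo : f (x + d) - f x > δ * ⟪G x, d⟫) :
    β > 2 * (1 - δ) / κ := by
  have hz := hP (x - β • G x)
  have hPz : P (x - β • G x) = x + d := by rw [hd]; abel
  rw [hPz] at hz
  have hproj : β * ⟪G x, d⟫ + ‖d‖ ^ 2 ≤ 0 := by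
    have : Nonempty Ω := hΩne.to_subtype
    have hinf : ‖(x - β • G x) - (x + d)‖ = ⨅ w : Ω, ‖(x - β • G x) - w‖ := by
      apply le_antisymm
      · exact le_ciInf fun w => hz.2 w w.2
      · exact ciInf_le (f := fun w : Ω => ‖(x - β • G x) - w‖)
          ⟨0, by rintro _ ⟨w, rfl⟩; exact norm_nonneg _⟩ ⟨x + d, hz.1⟩
    have h := (norm_eq_iInf_iff_real_inner_le_zero hΩconv hz.1).1 hinf x hx
    have e1 : (x - β • G x) - (x + d) = -(β • G x + d) := by abel
    have e2 : x - (x + d) = -d := by abel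
    rw [e1, e2, inner_neg_neg, inner_add_left, real_inner_smul_left,
      real_inner_self_eq_norm_sq] at h
    exact h
  have hder : ∀ t ∈ Set.Icc (0 : ℝ) 1,
      HasDerivAt (fun t : ℝ => f (x + t • d)) ⟪G (x + t • d), d⟫ t := by
    intro t ht
    have h1 : HasDerivAt (fun t : ℝ => x + t • d) d t := by
      simpa using ((hasDerivAt_id t).smul_const d).const_add x
    have h2 := (hdiff t ht).hasFDerivAt.comp_hasDerivAt t h1
    rw [InnerProductSpace.toDual_apply_apply] at h2
    exact h2
  have hB : ∀ t : ℝ, HasDerivAt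
      (fun t : ℝ => f x + t * ⟪G x, d⟫ + κ / 2 * ‖d‖ ^ 2 * t ^ 2)
      (⟪G x, d⟫ + κ * ‖d‖ ^ 2 * t) t := by
    intro t
    have h := (((hasDerivAt_id t).mul_const ⟪G x, d⟫).const_add (f x)).add
      (((hasDerivAt_id t).pow 2).const_mul (κ / 2 * ‖d‖ ^ 2))
    refine h.congr_deriv ?_
    simp
    ring
  have hdesc := image_le_of_deriv_right_le_deriv_boundary
    (fun t ht => (hder t ht).continuousAt.continuousWithinAt)
    (fun t ht => (hder t (Set.Ico_subset_Icc_self ht)).hasDerivWithinAt)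
    (by simp)
    (fun t _ => (hB t).continuousAt.continuousWithinAt)
    (fun t _ => (hB t).hasDerivWithinAt)
    (by
      intro t ht
      have h1 := hlip t (Set.Ico_subset_Icc_self ht) 0 (by simp)
      simp only [zero_smul, add_zero, sub_zero, abs_of_nonneg ht.1] at h1
      have h2 := real_inner_le_norm (G (x + t • d) - G x) d
      rw [inner_sub_left] at h2
      have h3 := mul_le_mul_of_nonneg_right h1 (norm_nonneg d)
      nlinarith)
    (Set.right_mem_Icc.2 (zero_le_one (α := ℝ)))
  simp only [one_smul, one_mul, one_pow, mul_one] at hdesc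
  have hD : 0 < ‖d‖ ^ 2 := by have := norm_pos_iff.2 hdne; positivity
  have h4 : 0 < (1 - δ) * ⟪G x, d⟫ + κ / 2 * ‖d‖ ^ 2 := by linarith
  have h5 := mul_pos hβ h4
  have h6 := mul_le_mul_of_nonneg_left hproj (sub_nonneg.2 hδ.2.le)
  have h7 : 0 < (β * κ / 2 - (1 - δ)) * ‖d‖ ^ 2 := by linarith
  have h8 := pos_of_mul_pos_left h7 hD.le
  rw [gt_iff_lt, div_lt_iff₀ hκ]
  linarith
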